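/- Let G be a simple graph on n vertices with det W(G) ≠ 0, and suppose rank_2 W(G) = ⌈n/2⌉ (with ⌈n/2⌉ < n). Let d_n be the n-th (largest) invariant factor of W(G). Then for every Q ∈ Q(G) with level ℓ, the integer d_n/2 is an integer and ℓ divides d_n/2. -/

import Mathlib

open Matrix Polynomial
open scoped Classical

noncomputable section

/-- The adjacency matrix of a simple graph on `Fin n`, with integer entries. -/
def adjMat (n : ℕ) (G : SimpleGraph (Fin n)) : Matrix (Fin n) (Fin n) ℤ :=
  Matrix.of fun i j => if G.Adj i j then 1 else 0

/-- The walk matrix `W = [e, Ae, ..., A^{n-1}e]` of a matrix `A`. -/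
def walkMat {n : ℕ} (A : Matrix (Fin n) (Fin n) ℤ) : Matrix (Fin n) (Fin n) ℤ :=
  Matrix.of fun i j => ((A ^ (j : ℕ)) *ᵥ fun _ => (1 : ℤ)) i

/-- Membership in `Q(G)`: `Q` is a regular rational orthogonal matrix such that
`Qᵀ A Q` is a 0-1 matrix. -/
def inQSet {n : ℕ} (A : Matrix (Fin n) (Fin n) ℤ) (Q : Matrix (Fin n) (Fin n) ℚ) : Prop :=
  Qᵀ * Q = 1 ∧ (Q *ᵥ fun _ => (1 : ℚ)) = (fun _ => 1) ∧
  ∀ i j, (Qᵀ * A.map (Int.cast : ℤ → ℚ) * Q) i j = 0 ∨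
         (Qᵀ * A.map (Int.cast : ℤ → ℚ) * Q) i j = 1

/-- `ℓ` is the level of the rational matrix `Q`: the smallest positive integer `k`
such that `k • Q` is an integral matrix. -/
def IsLevel {n : ℕ} (Q : Matrix (Fin n) (Fin n) ℚ) (ℓ : ℕ) : Prop :=
  0 < ℓ ∧ (∀ i j, ∃ z : ℤ, (ℓ : ℚ) * Q i j = z) ∧
  ∀ k : ℕ, 0 < k → (∀ i j, ∃ z : ℤ, (k : ℚ) * Q i j = z) → ℓ ≤ k

/-- A square integral matrix is unimodular if its determinant is a unit (i.e. `±1`). -/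
def IsUnimodular {n : ℕ} (U : Matrix (Fin n) (Fin n) ℤ) : Prop :=
  IsUnit U.det

/-- `diag d` is the Smith normal form of `W`: `W = U (diag d) V` with `U, V` unimodular
and `d_i ∣ d_{i+1}`. -/
def IsSNF {n : ℕ} (W : Matrix (Fin n) (Fin n) ℤ) (d : Fin n → ℤ) : Prop :=
  (∃ U V : Matrix (Fin n) (Fin n) ℤ, IsUnimodular U ∧ IsUnimodular V ∧
    W = U * Matrix.diagonal d * V) ∧
  ∀ i j : Fin n, i ≤ j → d i ∣ d j



lemma skew_coeff {n : ℕ} (S : Matrix (Fin n) (Fin n) ℤ) (hS : Sᵀ = -S) (i : ℕ)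
    (hi : (n + i) % 2 = 1) : S.charpoly.coeff i = 0 := by
  have h : S.charpoly.comp (C (-1) * X) = C ((-1) ^ n) * S.charpoly := by
    apply Polynomial.funext
    intro t
    have h2 : (scalar (Fin n) (-t) - S) = (-1 : ℤ) • (scalar (Fin n) t - S)ᵀ := by
      rw [transpose_sub, hS]
      ext a b
      by_cases hab : a = b
      · subst hab; simp; ring
      · simp; ring
    simp only [eval_comp, eval_mul, eval_C, eval_X, neg_mul, one_mul]
    rw [eval_charpoly, eval_charpoly, h2, det_smul, det_transpose]
    simp
  have h3 := congrArg (fun f => coeff f i) h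
  simp only [comp_C_mul_X_coeff, coeff_C_mul] at h3
  rcases Nat.even_or_odd n with hn | hn <;> rcases Nat.even_or_odd i with h4 | h4
  · obtain ⟨a, rfl⟩ := hn; obtain ⟨b, rfl⟩ := h4; omega
  · rw [hn.neg_one_pow, h4.neg_one_pow] at h3; linarith
  · rw [hn.neg_one_pow, h4.neg_one_pow] at h3; linarith
  · obtain ⟨a, rfl⟩ := hn; obtain ⟨b, rfl⟩ := h4; omega

lemma sq_of_deriv (f : (ZMod 2)[X]) (h : ∀ i, i % 2 = 1 → f.coeff i = 0) : ∃ g, f = g ^ 2 := by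
  refine ⟨contract 2 f, ?_⟩
  rw [← ZMod.expand_card, expand_contract]
  · ext i
    rw [coeff_derivative, coeff_zero]
    rcases Nat.mod_two_eq_zero_or_one (i + 1) with h1 | h1
    · have : ((i : ZMod 2) + 1) = 0 := by
        have : ((i + 1 : ℕ) : ZMod 2) = 0 := (ZMod.natCast_eq_zero_iff _ _).2 (Nat.dvd_of_mod_eq_zero h1)
        simpa using this
      rw [this, mul_zero]
    · rw [h _ h1, zero_mul]
  · norm_num

lemma charpoly_sq {n : ℕ} (A : Matrix (Fin n) (Fin n) ℤ) (hs : Aᵀ = A) (hd : ∀ i, A i i = 0) :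
    ∃ g : (ZMod 2)[X], (A.map (Int.cast : ℤ → ZMod 2)).charpoly = X ^ (n % 2) * g ^ 2 := by
  have hs' : ∀ i j, A i j = A j i := fun i j => by conv_lhs => rw [← hs, transpose_apply]
  let S : Matrix (Fin n) (Fin n) ℤ := of fun i j => if i < j then A i j else - A i j
  have hS : Sᵀ = -S := by
    ext i j
    simp only [S, transpose_apply, Matrix.neg_apply, of_apply]
    rcases lt_trichotomy i j with h | h | h
    · simp [h, h.le, hs' j i]
    · subst h; simp [hd]
    · simp [h, not_lt.2 h.le, hs' j i]
  have hSA : S.map (Int.castRingHom (ZMod 2)) = A.map (Int.cast : ℤ → ZMod 2) := by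
    ext i j
    simp only [S, map_apply, of_apply]
    split_ifs
    · rfl
    · simp [ZMod.neg_eq_self_mod_two]
  have hc : ∀ i, (n + i) % 2 = 1 → (A.map (Int.cast : ℤ → ZMod 2)).charpoly.coeff i = 0 := by
    intro i hi
    rw [← hSA, charpoly_map, coeff_map, skew_coeff S hS i hi, map_zero]
  rcases Nat.mod_two_eq_zero_or_one n with h | h
  · rw [h]
    obtain ⟨g, hg⟩ := sq_of_deriv _ (fun i hi => hc i (by omega))
    exact ⟨g, by simpa using hg⟩
  · rw [h]
    obtain ⟨g, hg⟩ := sq_of_deriv (divX (A.map (Int.cast : ℤ → ZMod 2)).charpoly)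
      (fun i hi => by rw [coeff_divX]; exact hc _ (by omega))
    refine ⟨g, ?_⟩
    rw [← hg, pow_one]
    have := divX_mul_X_add (A.map (Int.cast : ℤ → ZMod 2)).charpoly
    rw [hc 0 (by omega)] at this
    rw [mul_comm]; simpa using this.symm

lemma aeval_transp {n : ℕ} {R : Type*} [CommRing R] (A : Matrix (Fin n) (Fin n) R) (f : R[X]) :
    (aeval A f)ᵀ = aeval Aᵀ f := by
  rw [aeval_eq_sum_range, aeval_eq_sum_range, transpose_sum]
  simp [transpose_pow]

lemma aeval_cast {n : ℕ} (A : Matrix (Fin n) (Fin n) ℤ)  (f : ℤ[X]) :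
    (aeval A f).map (Int.cast : ℤ → ZMod 2) =
      aeval (A.map (Int.cast : ℤ → ZMod 2)) (f.map (Int.castRingHom (ZMod 2))) := by
  have := Polynomial.map_aeval_eq_aeval_map (R := ℤ) (S := Matrix (Fin n) (Fin n) ℤ) (T := ZMod 2)
    (U := Matrix (Fin n) (Fin n) (ZMod 2)) (φ := Int.castRingHom (ZMod 2))
    (ψ := (Int.castRingHom (ZMod 2)).mapMatrix) (by ext; simp) f A
  exact this

lemma z2sq (a : ZMod 2) : a * a = a := by revert a; decide

/-- `p(B)^2 = 0` implies `p(B) e = 0` over `F_2`, `B` symmetric. -/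
lemma pe_zero {n : ℕ} (P : Matrix (Fin n) (Fin n) (ZMod 2)) (hs : Pᵀ = P) (h : P * P = 0) :
    P *ᵥ (fun _ => 1) = 0 := by
  have key : ∀ x : Fin n → ZMod 2, (P *ᵥ (fun _ => 1)) ⬝ᵥ x = 0 := by
    intro x
    have h1 : (P *ᵥ x) ⬝ᵥ (P *ᵥ x) = 0 := by
      rw [dotProduct_mulVec, vecMul_mulVec, hs, h]; simp
    have h2 : (P *ᵥ x) ⬝ᵥ (P *ᵥ x) = (fun _ => (1 : ZMod 2)) ⬝ᵥ (P *ᵥ x) := by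
      simp only [dotProduct, z2sq, one_mul]
    rw [← h1, h2, dotProduct_mulVec, ← mulVec_transpose, hs]
  exact dotProduct_eq_zero _ key

/-- closed walks parity -/
lemma walk_even {n : ℕ} (A : Matrix (Fin n) (Fin n) (ZMod 2)) (hs : Aᵀ = A) (hd : ∀ i, A i i = 0)
    (k : ℕ) (hk : 0 < k) : (fun _ => (1 : ZMod 2)) ⬝ᵥ (A ^ k *ᵥ (fun _ => 1)) = 0 := by
  have hs' : ∀ i j, A i j = A j i := fun i j => by conv_lhs => rw [← hs, transpose_apply]
  have split : ∀ (m : ℕ) (x : Fin n → ZMod 2), (fun _ => (1 : ZMod 2)) ⬝ᵥ (A ^ m *ᵥ x)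
      = (A ^ m *ᵥ (fun _ => 1)) ⬝ᵥ x := by
    intro m x
    rw [dotProduct_mulVec, ← mulVec_transpose, transpose_pow, hs]
  have alt : ∀ u : Fin n → ZMod 2, u ⬝ᵥ (A *ᵥ u) = 0 := by
    intro u
    simp only [dotProduct, mulVec, Finset.mul_sum]
    rw [← Finset.sum_product']
    refine Finset.sum_involution (fun a _ => (a.2, a.1)) ?_ ?_ ?_ ?_
    · rintro ⟨a, b⟩ _
      simp only [hs' b a]
      rw [show u b * (A a b * u a) = u a * (A a b * u b) by ring, CharTwo.add_self_eq_zero]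
    · rintro ⟨a, b⟩ _ h hab
      simp only [Prod.mk.injEq] at hab
      obtain ⟨h1, h2⟩ := hab
      subst h1
      simp [hd] at h
    · simp
    · simp
  induction k using Nat.strong_induction_on with
  | _ k ih =>
    rcases Nat.even_or_odd' k with ⟨m, rfl | rfl⟩
    · rw [two_mul, pow_add, ← mulVec_mulVec, split]
      have := ih m (by omega) (by omega)
      simp only [dotProduct, z2sq]
      simpa [dotProduct] using this
    · rw [two_mul, add_assoc, pow_add, ← mulVec_mulVec, split, add_comm, pow_add, ← mulVec_mulVec,
        pow_one]
      rw [add_comm] at *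
      exact alt _

lemma ker_walk {n : ℕ} (hn : 0 < n) (A W : Matrix (Fin n) (Fin n) (ZMod 2)) (hs : Aᵀ = A)
    (hd : ∀ i, A i i = 0) (hW : ∀ j : Fin n, W.col j = A ^ (j : ℕ) *ᵥ (fun _ => 1))
    (hr : W.rank = (n + 1) / 2) (x : Fin n → ZMod 2) (hx : Wᵀ *ᵥ x = 0) :
    ∃ v, x = (A ^ (n % 2) * W) *ᵥ v := by
  have hmul : Wᵀ * (A ^ (n % 2) * W) = 0 := by
    ext i j
    have h1 : (Wᵀ * (A ^ (n % 2) * W)) i j = W.col i ⬝ᵥ (A ^ (n % 2) *ᵥ W.col j) := by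
      simp only [Matrix.mul_apply, dotProduct, mulVec, transpose_apply, col_apply]
    rw [h1, hW, hW, mulVec_mulVec, ← pow_add, Matrix.zero_apply]
    have h2 : (A ^ (i : ℕ) *ᵥ (fun _ => (1 : ZMod 2))) ⬝ᵥ (A ^ (n % 2 + j) *ᵥ (fun _ => (1 : ZMod 2))) =
       (fun _ => (1 : ZMod 2)) ⬝ᵥ (A ^ ((i : ℕ) + (n % 2 + j)) *ᵥ (fun _ => (1 : ZMod 2))) := by
      rw [pow_add A i, ← mulVec_mulVec, dotProduct_mulVec (fun _ => (1 : ZMod 2)), ← mulVec_transpose,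
        transpose_pow, hs]
    rw [h2]
    rcases Nat.eq_zero_or_pos ((i : ℕ) + (n % 2 + j)) with h | h
    · rw [h]
      have : ((n : ℕ) : ZMod 2) = 0 :=
        (ZMod.natCast_eq_zero_iff _ _).2 (Nat.dvd_of_mod_eq_zero (by omega))
      simp [dotProduct, this]
    · exact walk_even A hs hd _ h
  have hle : LinearMap.range (A ^ (n % 2) * W).mulVecLin ≤ LinearMap.ker Wᵀ.mulVecLin := by
    rintro _ ⟨v, rfl⟩
    rw [LinearMap.mem_ker, mulVecLin_apply, mulVecLin_apply, mulVec_mulVec, hmul, zero_mulVec]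
  have hdim : Module.finrank (ZMod 2) (LinearMap.range Wᵀ.mulVecLin) +
      Module.finrank (ZMod 2) (LinearMap.ker Wᵀ.mulVecLin) = n := by
    rw [LinearMap.finrank_range_add_finrank_ker]; simp
  have hr2 : Module.finrank (ZMod 2) (LinearMap.range Wᵀ.mulVecLin) = (n + 1) / 2 := by
    rw [← hr, ← rank_transpose]; rfl
  have hr3 : (n + 1) / 2 ≤ n % 2 + Module.finrank (ZMod 2) (LinearMap.range (A ^ (n % 2) * W).mulVecLin) := by
    rw [← hr]
    rcases Nat.mod_two_eq_zero_or_one n with h | h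
    · rw [h, pow_zero, one_mul, zero_add]; rfl
    · rw [h, pow_one]
      have : LinearMap.range W.mulVecLin ≤ Submodule.span (ZMod 2) {(fun _ => (1 : ZMod 2))} ⊔
          LinearMap.range (A * W).mulVecLin := by
        rw [range_mulVecLin, Submodule.span_le]
        rintro _ ⟨j, rfl⟩
        rw [hW]
        rcases Nat.eq_zero_or_pos (j : ℕ) with h0 | h0
        · rw [h0, pow_zero, one_mulVec]
          exact Submodule.mem_sup_left (Submodule.mem_span_singleton_self _)
        · refine Submodule.mem_sup_right ⟨Pi.single ⟨j - 1, by omega⟩ 1, ?_⟩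
          rw [mulVecLin_apply, ← mulVec_mulVec, mulVec_single_one, hW, mulVec_mulVec, ← pow_succ']
          congr 2
          simp; omega
      have h1 := Submodule.finrank_mono this
      have h2 := Submodule.finrank_add_le_finrank_add_finrank
        (Submodule.span (ZMod 2) {(fun _ : Fin n => (1 : ZMod 2))}) (LinearMap.range (A * W).mulVecLin)
      have h3 := finrank_span_singleton (K := ZMod 2) (v := (fun _ : Fin n => (1 : ZMod 2)))
        (fun h => one_ne_zero (congrFun h ⟨0, hn⟩))
      have h4 : W.rank = Module.finrank (ZMod 2) (LinearMap.range W.mulVecLin) := rfl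
      omega
  have heq := Submodule.eq_of_le_of_finrank_le hle (by omega)
  have : x ∈ LinearMap.range (A ^ (n % 2) * W).mulVecLin := by
    rw [heq]; exact hx
  obtain ⟨v, hv⟩ := this
  exact ⟨v, hv.symm⟩

lemma core {n : ℕ} (hn : 0 < n) (A B X' : Matrix (Fin n) (Fin n) ℤ) (hs : Aᵀ = A)
    (hd : ∀ i, A i i = 0) (hB : Bᵀ = B) (hchar : B.charpoly = A.charpoly)
    (hr : ((walkMat A).map (Int.cast : ℤ → ZMod 2)).rank = (n + 1) / 2)
    (d : ℤ) (hd0 : d ≠ 0) (hd2 : 2 ∣ d) (hXW : X' * walkMat A = d • (1 : Matrix (Fin n) (Fin n) ℤ))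
    (j : Fin n) (Y : Fin n → ℤ)
    (hY : (walkMat A)ᵀ *ᵥ Y = fun i : Fin n => d * (B ^ (i : ℕ) *ᵥ fun _ => 1) j) :
    ∀ i, 2 ∣ Y i := by
  set Ab := A.map (Int.cast : ℤ → ZMod 2) with hAb
  set Bb := B.map (Int.cast : ℤ → ZMod 2) with hBb
  set Wb := (walkMat A).map (Int.cast : ℤ → ZMod 2) with hWb
  have hsb : Abᵀ = Ab := by rw [hAb, ← transpose_map, hs]
  have hBbs : Bbᵀ = Bb := by rw [hBb, ← transpose_map, hB]
  have hdb : ∀ i, Ab i i = 0 := fun i => by simp [hAb, hd]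
  have cmv : ∀ (M : Matrix (Fin n) (Fin n) ℤ) (v : Fin n → ℤ) (i : Fin n),
      (((M *ᵥ v) i : ℤ) : ZMod 2) = (M.map (Int.cast : ℤ → ZMod 2) *ᵥ fun k => (v k : ZMod 2)) i := by
    intro M v i; simp [mulVec, dotProduct]
  have cpow : ∀ (M : Matrix (Fin n) (Fin n) ℤ) (k : ℕ),
      (M ^ k).map (Int.cast : ℤ → ZMod 2) = (M.map (Int.cast : ℤ → ZMod 2)) ^ k := by
    intro M k; exact map_pow (Int.castRingHom (ZMod 2)).mapMatrix M k
  have hWcol : ∀ j : Fin n, Wb.col j = Ab ^ (j : ℕ) *ᵥ (fun _ => 1) := by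
    intro j; ext i
    simp only [hWb, col_apply, map_apply, walkMat, of_apply]
    rw [cmv, cpow]; simp [hAb]
  obtain ⟨g, hg⟩ := charpoly_sq A hs hd
  rw [← hAb] at hg
  have hgB : Bb.charpoly = X ^ (n % 2) * g ^ 2 := by
    rw [← hg, hAb, hBb]
    have h1 := charpoly_map B (Int.castRingHom (ZMod 2))
    have h2 := charpoly_map A (Int.castRingHom (ZMod 2))
    rw [hchar, ← h2] at h1
    exact h1
  set p : (ZMod 2)[X] := X ^ (n % 2) * g with hp
  have pann : ∀ M : Matrix (Fin n) (Fin n) (ZMod 2), Mᵀ = M → M.charpoly = X ^ (n % 2) * g ^ 2 →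
      aeval M p *ᵥ (fun _ => (1 : ZMod 2)) = 0 := by
    intro M hM hc
    refine pe_zero _ (by rw [aeval_transp, hM]) ?_
    rw [← map_mul, show p * p = X ^ (n % 2) * M.charpoly by rw [hc, hp]; ring, map_mul,
      aeval_self_charpoly, mul_zero]
  have g0 : g ≠ 0 := by
    rintro rfl
    have := Ab.charpoly_monic.ne_zero
    rw [hg] at this; simp at this
  -- functional
  let φ : (ZMod 2)[X] →ₗ[ZMod 2] ZMod 2 :=
    { toFun := fun f => (aeval Bb f *ᵥ (fun _ => (1 : ZMod 2))) j
      map_add' := fun a b => by simp [add_mulVec]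
      map_smul' := fun a b => by simp [smul_mulVec] }
  have hφp : ∀ f, φ (f * p) = 0 := by
    intro f
    change (aeval Bb (f * p) *ᵥ (fun _ => (1 : ZMod 2))) j = 0
    rw [map_mul, ← mulVec_mulVec, pann Bb hBbs hgB, mulVec_zero]; rfl
  obtain ⟨L, hL⟩ := LinearMap.exists_leftInverse_of_injective (LinearMap.mulLeft (ZMod 2) g)
    (by
      rw [LinearMap.ker_eq_bot]
      intro a b hab
      exact mul_left_cancel₀ g0 hab)
  have hL' : ∀ f, L (g * f) = f := fun f => LinearMap.congr_fun hL f
  let α : (ZMod 2)[X] →ₗ[ZMod 2] ZMod 2 := φ ∘ₗ L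
  have hα : ∀ f, α (g * f) = φ f := fun f => by simp [α, hL']
  have hαχ : ∀ f, α (Ab.charpoly * f) = 0 := by
    intro f
    rw [hg, show X ^ (n % 2) * g ^ 2 * f = g * (f * p) by rw [hp]; ring, hα, hφp]
  have hlift : ∀ z : ZMod 2, ∃ a : ℤ, (a : ZMod 2) = z := ZMod.intCast_surjective
  choose lift hlift using hlift
  let a : Fin n → ℤ := fun i => lift (α (X ^ (i : ℕ)))
  have ha : ∀ i, (a i : ZMod 2) = α (X ^ (i : ℕ)) := fun i => hlift _
  let x : Fin n → ℤ := X'ᵀ *ᵥ a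
  have hWX : walkMat A * X' = d • (1 : Matrix (Fin n) (Fin n) ℤ) := by
    have h1 : (walkMat A * X') * walkMat A = (d • (1 : Matrix (Fin n) (Fin n) ℤ)) * walkMat A := by
      rw [Matrix.mul_assoc, hXW, Matrix.mul_smul, Matrix.smul_mul, Matrix.mul_one, Matrix.one_mul]
    have h2 : (walkMat A).det ≠ 0 := by
      intro h
      have := congrArg Matrix.det hXW
      rw [det_mul, h, det_smul, det_one, mul_zero, mul_one] at this
      exact (pow_ne_zero _ hd0) this.symm
    have h3 : (walkMat A * X' - d • (1 : Matrix (Fin n) (Fin n) ℤ)) * walkMat A = 0 := by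
      rw [Matrix.sub_mul, h1, sub_self]
    have h4 : (walkMat A * X' - d • (1 : Matrix (Fin n) (Fin n) ℤ)) * (walkMat A * (walkMat A).adjugate) = 0 := by
      rw [← Matrix.mul_assoc, h3, Matrix.zero_mul]
    rw [mul_adjugate, Matrix.mul_smul, Matrix.mul_one] at h4
    exact sub_eq_zero.1 ((smul_eq_zero.1 h4).resolve_left h2)
  have hx : (walkMat A)ᵀ *ᵥ x = d • a := by
    simp only [x]
    rw [mulVec_mulVec, ← transpose_mul, hXW]; simp
  have hWT : ∀ (v : Fin n → ℤ) (i : Fin n), ((walkMat A)ᵀ *ᵥ v) i = (fun _ => (1 : ℤ)) ⬝ᵥ (A ^ (i : ℕ) *ᵥ v) := by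
    intro v i
    rw [dotProduct_mulVec, ← mulVec_transpose, transpose_pow, hs]
    rfl
  -- key functional identity
  have key : ∀ f : ℤ[X], ∃ s : ℤ, (fun _ => (1 : ℤ)) ⬝ᵥ (aeval A f *ᵥ x) = d * s ∧
      (s : ZMod 2) = α (f.map (Int.castRingHom (ZMod 2))) := by
    intro f
    have hmon := A.charpoly_monic
    set r := f %ₘ A.charpoly with hr'
    have hf : r + A.charpoly * (f /ₘ A.charpoly) = f := modByMonic_add_div f _
    have hdeg : r.natDegree < n := by
      have := natDegree_modByMonic_lt f hmon (by
        intro h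
        have h2 := A.charpoly_natDegree_eq_dim
        rw [h] at h2; simp at h2; omega)
      rwa [A.charpoly_natDegree_eq_dim, Fintype.card_fin] at this
    have hAf : aeval A f = aeval A r := by
      conv_lhs => rw [← hf]
      rw [map_add, map_mul, aeval_self_charpoly, zero_mul, add_zero]
    have hαf : α (f.map (Int.castRingHom (ZMod 2))) = α (r.map (Int.castRingHom (ZMod 2))) := by
      conv_lhs => rw [← hf]
      rw [Polynomial.map_add, Polynomial.map_mul, ← charpoly_map, map_add]
      have := hαχ ((f /ₘ A.charpoly).map (Int.castRingHom (ZMod 2)))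
      erw [this]; rw [add_zero]
    refine ⟨∑ i : Fin n, r.coeff i * a i, ?_, ?_⟩
    · rw [hAf, aeval_eq_sum_range' hdeg, Finset.sum_range, sum_mulVec, dotProduct_sum, Finset.mul_sum]
      refine Finset.sum_congr rfl fun i _ => ?_
      rw [smul_mulVec, dotProduct_smul, ← hWT, hx]
      simp; ring
    · rw [hαf]
      conv_rhs => rw [as_sum_range' r n hdeg]
      rw [Polynomial.map_sum, map_sum, Finset.sum_range, Int.cast_sum]
      refine Finset.sum_congr rfl fun i _ => ?_
      rw [Polynomial.map_monomial, ← C_mul_X_pow_eq_monomial, ← smul_eq_C_mul, map_smul, ← ha]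
      simp
  obtain ⟨gh, hgh⟩ := Polynomial.map_surjective (Int.castRingHom (ZMod 2)) ZMod.intCast_surjective g
  set v := Y - aeval A gh *ᵥ x with hv
  have hb : ∀ i, ∃ b : ℤ, ((walkMat A)ᵀ *ᵥ v) i = d * (2 * b) := by
    intro i
    obtain ⟨s, hs1, hs2⟩ := key (gh * X ^ (i : ℕ))
    rw [Polynomial.map_mul, hgh, Polynomial.map_pow, map_X, hα] at hs2
    have h1 : ((walkMat A)ᵀ *ᵥ (aeval A gh *ᵥ x)) i = d * s := by
      rw [hWT, ← hs1, mul_comm, map_mul, mulVec_mulVec]; simp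
    have h2 : φ (X ^ (i : ℕ)) = (((B ^ (i : ℕ) *ᵥ fun _ => 1) j : ℤ) : ZMod 2) := by
      rw [cmv, cpow]
      change (aeval Bb (X ^ (i : ℕ)) *ᵥ (fun _ => (1 : ZMod 2))) j = _
      simp [hBb]
    rw [h2] at hs2
    have h3 : (2 : ℤ) ∣ (B ^ (i : ℕ) *ᵥ fun _ => 1) j - s := by
      have := (ZMod.intCast_zmod_eq_zero_iff_dvd ((B ^ (i : ℕ) *ᵥ fun _ => 1) j - s) 2).1
        (by rw [Int.cast_sub, hs2, sub_self])
      exact_mod_cast this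
    obtain ⟨b, hb⟩ := h3
    refine ⟨b, ?_⟩
    rw [hv, mulVec_sub, Pi.sub_apply, h1, hY, ← hb]; ring
  choose b hb using hb
  have hv2 : ∀ i, v i = 2 * (X'ᵀ *ᵥ b) i := by
    intro i
    have h1 : X'ᵀ *ᵥ ((walkMat A)ᵀ *ᵥ v) = d • v := by
      rw [mulVec_mulVec, ← transpose_mul, hWX]; simp
    have h2 : (walkMat A)ᵀ *ᵥ v = (d * 2) • b := by
      ext i; rw [hb]; simp; ring
    rw [h2, mulVec_smul] at h1
    have := congrFun h1 i
    simp only [Pi.smul_apply, smul_eq_mul] at this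
    apply mul_left_cancel₀ hd0
    rw [← this]; ring
  -- parity of `g(A) x`
  have hxb : Wbᵀ *ᵥ (fun k => (x k : ZMod 2)) = 0 := by
    ext i
    rw [hWb, ← transpose_map, ← cmv, hx]
    have : (d : ZMod 2) = 0 := (ZMod.intCast_zmod_eq_zero_iff_dvd d 2).2 (by exact_mod_cast hd2)
    simp [this]
  obtain ⟨w, hw⟩ := ker_walk hn Ab Wb hsb hdb hWcol hr _ hxb
  have hpW : aeval Ab p * Wb = 0 := by
    ext i k
    have h1 : (aeval Ab p * Wb) i k = (aeval Ab p *ᵥ Wb.col k) i := rfl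
    rw [h1, hWcol, mulVec_mulVec, show aeval Ab p * Ab ^ (k : ℕ) = Ab ^ (k : ℕ) * aeval Ab p by
      have : aeval Ab (p * X ^ (k : ℕ)) = aeval Ab (X ^ (k : ℕ) * p) := by rw [mul_comm]
      simpa using this, ← mulVec_mulVec, pann Ab hsb hg, mulVec_zero]
    rfl
  intro i
  have h1 : (((aeval A gh *ᵥ x) i : ℤ) : ZMod 2) = 0 := by
    rw [cmv, aeval_cast, hgh, hw, mulVec_mulVec, ← Matrix.mul_assoc,
      show aeval Ab g * Ab ^ (n % 2) = aeval Ab p by rw [hp, mul_comm]; simp, hpW]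
    simp
  have h2 : (2 : ℤ) ∣ (aeval A gh *ᵥ x) i := by
    exact_mod_cast (ZMod.intCast_zmod_eq_zero_iff_dvd _ 2).1 h1
  have h3 : Y i = v i + (aeval A gh *ᵥ x) i := by simp [hv]
  rw [h3, hv2]
  exact dvd_add (dvd_mul_right _ _) h2

lemma level_dvd {n : ℕ} (Q : Matrix (Fin n) (Fin n) ℚ) (ℓ : ℕ) (hℓ : IsLevel Q ℓ) (k : ℤ)
    (hk : ∀ i j, ∃ z : ℤ, (k : ℚ) * Q i j = z) : (ℓ : ℤ) ∣ k := by
  obtain ⟨h0, h1, h2⟩ := hℓ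
  have hl0 : (0 : ℤ) < ℓ := by exact_mod_cast h0
  by_contra hnd
  have hr0 : 0 ≤ k % ℓ := Int.emod_nonneg _ hl0.ne'
  have hr1 : k % ℓ < ℓ := Int.emod_lt_of_pos _ hl0
  have hr2 : k % ℓ ≠ 0 := fun h => hnd (Int.dvd_of_emod_eq_zero h)
  have := h2 (k % ℓ).toNat (by omega) (by
    intro i j
    obtain ⟨z1, hz1⟩ := hk i j
    obtain ⟨z2, hz2⟩ := h1 i j
    refine ⟨z1 - (k / ℓ) * z2, ?_⟩
    have h3 : (((k % ℓ).toNat : ℤ) : ℚ) = ((k - ℓ * (k / ℓ) : ℤ) : ℚ) := by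
      rw [Int.toNat_of_nonneg hr0, Int.emod_def]
    rw [Int.cast_natCast] at h3
    rw [h3]
    push_cast
    rw [← hz1, ← hz2]; ring)
  omega

lemma snf_inv {n : ℕ} (W : Matrix (Fin n) (Fin n) ℤ) (d : Fin n → ℤ) (hSNF : IsSNF W d)
    (m : Fin n) (hm : ∀ i, i ≤ m) :
    ∃ X' : Matrix (Fin n) (Fin n) ℤ, X' * W = d m • (1 : Matrix (Fin n) (Fin n) ℤ) := by
  obtain ⟨⟨U, V, hU, hV, rfl⟩, hdvd⟩ := hSNF
  choose c hc using fun i => hdvd i m (hm i)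
  refine ⟨V⁻¹ * diagonal c * U⁻¹, ?_⟩
  have h1 : U⁻¹ * U = 1 := nonsing_inv_mul _ hU
  have h2 : V⁻¹ * V = 1 := nonsing_inv_mul _ hV
  have h3 : diagonal c * diagonal d = d m • (1 : Matrix (Fin n) (Fin n) ℤ) := by
    rw [diagonal_mul_diagonal, smul_one_eq_diagonal]
    congr 1; ext i; rw [hc i, mul_comm]
  calc V⁻¹ * diagonal c * U⁻¹ * (U * diagonal d * V)
      = V⁻¹ * (diagonal c * (U⁻¹ * U) * diagonal d) * V := by simp only [Matrix.mul_assoc]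
    _ = d m • (1 : Matrix (Fin n) (Fin n) ℤ) := by
      rw [h1, Matrix.mul_one, h3, Matrix.mul_smul, Matrix.smul_mul, Matrix.mul_one, h2]

/-- if `det W(G) ≠ 0` and `rank_2 W(G) = ⌈n/2⌉ < n`, then `2 ∣ d_n` and every
`Q ∈ Q(G)` with level `ℓ` satisfies `ℓ ∣ d_n / 2`. -/
theorem stmt2 (n : ℕ) (hn : 0 < n) (G : SimpleGraph (Fin n))
    (hdet : (walkMat (adjMat n G)).det ≠ 0)
    (hrank : ((walkMat (adjMat n G)).map (Int.cast : ℤ → ZMod 2)).rank = (n + 1) / 2)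
    (hlt : (n + 1) / 2 < n)
    (d : Fin n → ℤ) (hSNF : IsSNF (walkMat (adjMat n G)) d)
    (Q : Matrix (Fin n) (Fin n) ℚ) (hQ : inQSet (adjMat n G) Q)
    (ℓ : ℕ) (hℓ : IsLevel Q ℓ) :
    (2 : ℤ) ∣ d ⟨n - 1, Nat.sub_lt hn Nat.one_pos⟩ ∧
    (ℓ : ℤ) ∣ d ⟨n - 1, Nat.sub_lt hn Nat.one_pos⟩ / (2 : ℤ) := by
  
  set A := adjMat n G with hA
  set m : Fin n := ⟨n - 1, Nat.sub_lt hn Nat.one_pos⟩ with hm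
  have hs : Aᵀ = A := by
    ext i j; simp [hA, adjMat, G.adj_comm]
  have hdiag : ∀ i, A i i = 0 := fun i => by simp [hA, adjMat]
  obtain ⟨X', hXW⟩ := snf_inv _ d hSNF m (fun i => by
    rw [Fin.le_def]; have := i.2; simp only [hm]; omega)
  have hWX : walkMat A * X' = d m • (1 : Matrix (Fin n) (Fin n) ℤ) := by
    have h3 : (walkMat A * X' - d m • (1 : Matrix (Fin n) (Fin n) ℤ)) * walkMat A = 0 := by
      rw [Matrix.sub_mul, Matrix.mul_assoc, hXW, Matrix.mul_smul, Matrix.smul_mul, Matrix.mul_one,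
        Matrix.one_mul, sub_self]
    have h4 : (walkMat A * X' - d m • (1 : Matrix (Fin n) (Fin n) ℤ)) *
        (walkMat A * (walkMat A).adjugate) = 0 := by
      rw [← Matrix.mul_assoc, h3, Matrix.zero_mul]
    rw [mul_adjugate, Matrix.mul_smul, Matrix.mul_one] at h4
    exact sub_eq_zero.1 ((smul_eq_zero.1 h4).resolve_left hdet)
  have hd0 : d m ≠ 0 := by
    obtain ⟨⟨U, V, hU, hV, hW⟩, -⟩ := hSNF
    intro h
    apply hdet
    rw [hW, det_mul, det_mul, det_diagonal, Finset.prod_eq_zero (Finset.mem_univ m) h]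
    simp
  have hd2 : (2 : ℤ) ∣ d m := by
    by_contra hnd
    have h1 : ((d m : ℤ) : ZMod 2) ≠ 0 := fun h => hnd
      (by exact_mod_cast (ZMod.intCast_zmod_eq_zero_iff_dvd _ 2).1 h)
    have h2 : ((walkMat A).map (Int.cast : ℤ → ZMod 2)).det ≠ 0 := by
      have h3 := congrArg (fun M => ((Matrix.det M : ℤ) : ZMod 2)) hXW
      simp only [det_mul, det_smul, det_one, mul_one, Int.cast_mul, Int.cast_pow] at h3
      have h4 : ((walkMat A).map (Int.cast : ℤ → ZMod 2)).det = ((walkMat A).det : ZMod 2) :=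
        ((Int.castRingHom (ZMod 2)).map_det _).symm
      rw [h4]
      intro h5
      rw [h5, mul_zero] at h3
      exact pow_ne_zero _ h1 h3.symm
    have h6 := rank_of_isUnit ((walkMat A).map (Int.cast : ℤ → ZMod 2))
      ((Matrix.isUnit_iff_isUnit_det _).2 (isUnit_iff_ne_zero.2 h2))
    rw [hrank, Fintype.card_fin] at h6
    omega
  refine ⟨hd2, ?_⟩
  obtain ⟨hQ1, hQe, h01⟩ := hQ
  have hQ2 : Q * Qᵀ = 1 := mul_eq_one_comm.1 hQ1
  have hQTe : Qᵀ *ᵥ (fun _ => (1 : ℚ)) = fun _ => 1 := by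
    conv_lhs => rw [← hQe]
    rw [mulVec_mulVec, hQ1, one_mulVec]
  set Aq := A.map (Int.cast : ℤ → ℚ) with hAq
  have hBex : ∀ i j, ∃ z : ℤ, (z : ℚ) = (Qᵀ * Aq * Q) i j := by
    intro i j
    rcases h01 i j with h | h
    · exact ⟨0, by rw [h]; simp⟩
    · exact ⟨1, by rw [h]; simp⟩
  choose B' hB' using hBex
  let B : Matrix (Fin n) (Fin n) ℤ := of B'
  have hBq : B.map (Int.cast : ℤ → ℚ) = Qᵀ * Aq * Q := by
    ext i j; exact hB' i j
  have hinj : Function.Injective (fun M : Matrix (Fin n) (Fin n) ℤ => M.map (Int.cast : ℤ → ℚ)) :=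
    Matrix.map_injective Int.cast_injective
  have hAqs : Aqᵀ = Aq := by rw [hAq, ← transpose_map, hs]
  have hBs : Bᵀ = B := by
    apply hinj
    change Bᵀ.map (Int.cast : ℤ → ℚ) = B.map (Int.cast : ℤ → ℚ)
    rw [transpose_map, hBq, transpose_mul, transpose_mul, hAqs, transpose_transpose,
      Matrix.mul_assoc]
  have hchar : B.charpoly = A.charpoly := by
    apply Polynomial.map_injective (Int.castRingHom ℚ) Int.cast_injective
    rw [← charpoly_map, ← charpoly_map]
    change (B.map (Int.cast : ℤ → ℚ)).charpoly = Aq.charpoly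
    rw [hBq, charpoly_mul_comm, ← Matrix.mul_assoc, hQ2, Matrix.one_mul]
  have hcomm : ∀ k : ℕ, Qᵀ * Aq ^ k = (B.map (Int.cast : ℤ → ℚ)) ^ k * Qᵀ := by
    intro k
    have h1 : SemiconjBy Qᵀ Aq (B.map (Int.cast : ℤ → ℚ)) := by
      change Qᵀ * Aq = B.map (Int.cast : ℤ → ℚ) * Qᵀ
      rw [hBq, Matrix.mul_assoc _ Q, hQ2, Matrix.mul_one]
    exact h1.pow_right k
  have cpow : ∀ (M : Matrix (Fin n) (Fin n) ℤ) (k : ℕ),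
      (M ^ k).map (Int.cast : ℤ → ℚ) = (M.map (Int.cast : ℤ → ℚ)) ^ k := by
    intro M k; exact map_pow (Int.castRingHom ℚ).mapMatrix M k
  have cmul : ∀ (M N : Matrix (Fin n) (Fin n) ℤ),
      (M * N).map (Int.cast : ℤ → ℚ) = M.map (Int.cast : ℤ → ℚ) * N.map (Int.cast : ℤ → ℚ) := by
    intro M N; exact map_mul (Int.castRingHom ℚ).mapMatrix M N
  have wcol : ∀ (M : Matrix (Fin n) (Fin n) ℤ) (k : Fin n),
      ((walkMat M).map (Int.cast : ℤ → ℚ)).col k =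
        (M.map (Int.cast : ℤ → ℚ)) ^ (k : ℕ) *ᵥ (fun _ => 1) := by
    intro M k
    rw [← cpow]
    ext i
    simp [walkMat, mulVec, dotProduct]
  have hQW : Qᵀ * (walkMat A).map (Int.cast : ℤ → ℚ) = (walkMat B).map (Int.cast : ℤ → ℚ) := by
    ext i k
    have h1 : (Qᵀ * (walkMat A).map (Int.cast : ℤ → ℚ)) i k =
      (Qᵀ *ᵥ ((walkMat A).map (Int.cast : ℤ → ℚ)).col k) i := rfl
    have h2 : ((walkMat B).map (Int.cast : ℤ → ℚ)) i k =
      (((walkMat B).map (Int.cast : ℤ → ℚ)).col k) i := rfl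
    rw [h1, h2, wcol, wcol, mulVec_mulVec, ← hAq, hcomm, ← mulVec_mulVec, hQTe]
  let Y : Matrix (Fin n) (Fin n) ℤ := X'ᵀ * (walkMat B)ᵀ
  have hYQ : Y.map (Int.cast : ℤ → ℚ) = (d m : ℚ) • Q := by
    have h1 : (walkMat B * X').map (Int.cast : ℤ → ℚ) = (d m : ℚ) • Qᵀ := by
      rw [cmul, ← hQW, Matrix.mul_assoc, ← cmul, hWX]
      have : (d m • (1 : Matrix (Fin n) (Fin n) ℤ)).map (Int.cast : ℤ → ℚ) =
          (d m : ℚ) • (1 : Matrix (Fin n) (Fin n) ℚ) := by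
        ext i j
        simp only [Matrix.map_apply, Matrix.smul_apply, Matrix.one_apply, smul_eq_mul]
        split_ifs <;> simp
      rw [this, Matrix.mul_smul, Matrix.mul_one]
    have h2 : Y = (walkMat B * X')ᵀ := by rw [transpose_mul]
    rw [h2, transpose_map, h1, transpose_smul, transpose_transpose]
  have heven : ∀ i j, (2 : ℤ) ∣ Y i j := by
    intro i j
    refine core hn A B X' hs hdiag hBs hchar hrank (d m) hd0 hd2 hXW j (fun i => Y i j) ?_ i
    have h1 : (walkMat A)ᵀ * Y = d m • (walkMat B)ᵀ := by
      rw [← Matrix.mul_assoc, ← transpose_mul, hXW]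
      simp
    ext k
    exact congrFun (congrFun h1 k) j
  apply level_dvd Q ℓ hℓ
  intro i j
  obtain ⟨y, hy⟩ := heven i j
  obtain ⟨e, he⟩ := hd2
  refine ⟨y, ?_⟩
  have h1 := congrFun (congrFun hYQ i) j
  rw [Matrix.map_apply, hy, Matrix.smul_apply, smul_eq_mul] at h1
  rw [he] at h1 ⊢
  rw [Int.mul_ediv_cancel_left _ (by norm_num)]
  push_cast at h1
  linarith
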